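/- Let Γ be a finite-dimensional K-algebra and P a projective Γ-module. If T and T' are both P-special tilting Γ-modules, then add T = add T'. In particular, any two basic P-special tilting Γ-modules are isomorphic. -/

import Mathlib

/- Preliminary notions: `add`, `gen`, `cogen`, generators and cogenerators,
short exact sequences, basic modules, indecomposability. -/

noncomputable section

namespace GenFinitePaper

open Function

variable (R : Type) [Ring R]

/-- `M` lies in `add X`, i.e. `M` is a direct summand of a finite direct sum of copies of `X`. -/
def InAdd (X : Type) [AddCommGroup X] [Module R X]
    (M : Type) [AddCommGroup M] [Module R M] : Prop :=
  ∃ (n : ℕ) (i : M →ₗ[R] (Fin n → X)) (p : (Fin n → X) →ₗ[R] M), p.comp i = LinearMap.id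

/-- `M` lies in `gen X`, i.e. `M` is an epimorphic image of a module in `add X`. -/
def InGen (X : Type) [AddCommGroup X] [Module R X]
    (M : Type) [AddCommGroup M] [Module R M] : Prop :=
  ∃ (n : ℕ) (p : (Fin n → X) →ₗ[R] M), Surjective p

/-- `M` lies in `cogen X`, i.e. `M` embeds into a module in `add X`. -/
def InCogen (X : Type) [AddCommGroup X] [Module R X]
    (M : Type) [AddCommGroup M] [Module R M] : Prop :=
  ∃ (n : ℕ) (i : M →ₗ[R] (Fin n → X)), Injective i

/-- `E` is a generator for `mod R`: `R ∈ add E`. -/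
def IsGenerator (E : Type) [AddCommGroup E] [Module R E] : Prop :=
  InAdd R E R

/-- `E` is a cogenerator for `mod R`: every finitely generated (equivalently, over a
finite-dimensional algebra, finite-dimensional) module embeds into a module in `add E`. -/
def IsCogenerator (E : Type) [AddCommGroup E] [Module R E] : Prop :=
  ∀ (M : Type) [AddCommGroup M] [Module R M], Module.Finite R M → InCogen R E M

/-- A short exact sequence `0 → X → Y → Z → 0` of modules, given by a pair of composable
linear maps. -/
def IsShortExact {X Y Z : Type} [AddCommGroup X] [Module R X] [AddCommGroup Y] [Module R Y]
    [AddCommGroup Z] [Module R Z] (f : X →ₗ[R] Y) (g : Y →ₗ[R] Z) : Prop :=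
  Injective f ∧ Surjective g ∧ Exact f g

/-- A module is basic if it has no repeated indecomposable direct summands; equivalently
(by Krull--Remak--Schmidt) no nonzero module `X` is such that `X ⊕ X` is a direct summand. -/
def IsBasic (M : Type) [AddCommGroup M] [Module R M] : Prop :=
  ∀ (X Y : Type) [AddCommGroup X] [Module R X] [AddCommGroup Y] [Module R Y],
    Nonempty (M ≃ₗ[R] ((X × X) × Y)) → Subsingleton X

/-- A module is indecomposable if it is nonzero and admits no nontrivial idempotent
endomorphism. -/
def Indecomposable (M : Type) [AddCommGroup M] [Module R M] : Prop :=
  Nontrivial M ∧ ∀ φ : M →ₗ[R] M, φ.comp φ = φ → φ = 0 ∨ φ = LinearMap.id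

end GenFinitePaper
/- K-linear duality: the dual of the regular module, duals of modules over endomorphism
rings, and Hom-modules over endomorphism rings. -/

namespace GenFinitePaper

open Function

variable (K : Type) [Field K]

/-- `D R = Hom_K(R, K)`, the `K`-linear dual of a `K`-algebra `R`, viewed as a left
`R`-module via `(r • f) x = f (x * r)`. -/
def RegularDual (R : Type) [Ring R] [Algebra K R] : Type := R →ₗ[K] K

namespace RegularDual

variable (R : Type) [Ring R] [Algebra K R]

instance : AddCommGroup (RegularDual K R) := inferInstanceAs (AddCommGroup (R →ₗ[K] K))

instance : Module K (RegularDual K R) := inferInstanceAs (Module K (R →ₗ[K] K))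

/-- The action of `R` on its `K`-linear dual, by `(r • f) x = f (x * r)`. -/
def actHom : R →+* Module.End K (R →ₗ[K] K) where
  toFun r := (LinearMap.mulRight K r).lcomp K K
  map_one' := by ext f x; simp
  map_mul' r s := by ext f x; simp [mul_assoc]
  map_zero' := by ext f x; simp
  map_add' r s := by ext f x; simp [mul_add]

instance : Module R (RegularDual K R) :=
  Module.compHom (R →ₗ[K] K) (actHom K R)

lemma smul_def (r : R) (f : RegularDual K R) :
    r • f = (f : R →ₗ[K] K).comp (LinearMap.mulRight K r) := rfl

end RegularDual

/-- `D M = Hom_K(M, K)`, the `K`-linear dual of a module `M` over a `K`-algebra `R`,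
viewed as a left module over `End_R(M)ᵒᵖ` via `(φᵒᵖ • f) = f ∘ φ`. -/
def ModuleDual (R : Type) [Ring R] [Algebra K R] (M : Type) [AddCommGroup M] [Module R M]
    [Module K M] [IsScalarTower K R M] : Type := M →ₗ[K] K

namespace ModuleDual

variable (R : Type) [Ring R] [Algebra K R] (M : Type) [AddCommGroup M] [Module R M]
  [Module K M] [IsScalarTower K R M]

instance : AddCommGroup (ModuleDual K R M) := inferInstanceAs (AddCommGroup (M →ₗ[K] K))

instance : Module K (ModuleDual K R M) := inferInstanceAs (Module K (M →ₗ[K] K))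

/-- The action of `End_R(M)ᵒᵖ` on `Hom_K(M, K)` by precomposition. -/
def actHom : (Module.End R M)ᵐᵒᵖ →+* Module.End K (M →ₗ[K] K) where
  toFun φ := (LinearMap.restrictScalars K φ.unop).lcomp K K
  map_one' := by ext f x; rfl
  map_mul' φ ψ := by ext f x; rfl
  map_zero' := by ext f x; simp
  map_add' φ ψ := by ext f x; simp

instance : Module (Module.End R M)ᵐᵒᵖ (ModuleDual K R M) :=
  Module.compHom (M →ₗ[K] K) (actHom K R M)

lemma smul_def (φ : (Module.End R M)ᵐᵒᵖ) (f : ModuleDual K R M) :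
    φ • f = (f : M →ₗ[K] K).comp (LinearMap.restrictScalars K φ.unop) := rfl

end ModuleDual

/-- `Hom_R(E, N)` viewed as a left module over `Γ = End_R(E)ᵒᵖ` via `(φᵒᵖ • g) = g ∘ φ`. -/
def HomOp (R : Type) [Ring R] (E : Type) [AddCommGroup E] [Module R E]
    (N : Type) [AddCommGroup N] [Module R N] : Type := E →ₗ[R] N

namespace HomOp

variable (R : Type) [Ring R] (E : Type) [AddCommGroup E] [Module R E]
  (N : Type) [AddCommGroup N] [Module R N]

instance : AddCommGroup (HomOp R E N) := inferInstanceAs (AddCommGroup (E →ₗ[R] N))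

/-- The action of `End_R(E)ᵒᵖ` on `Hom_R(E, N)` by precomposition. -/
def actHom : (Module.End R E)ᵐᵒᵖ →+* Module.End ℤ (E →ₗ[R] N) where
  toFun φ :=
    { toFun := fun g => (g : E →ₗ[R] N).comp φ.unop
      map_add' := fun g h => LinearMap.add_comp _ _ _
      map_smul' := fun n g => LinearMap.smul_comp n g φ.unop }
  map_one' := by ext g x; rfl
  map_mul' φ ψ := by ext g x; rfl
  map_zero' := by ext g x; simp
  map_add' φ ψ := by ext g x; simp

instance : Module (Module.End R E)ᵐᵒᵖ (HomOp R E N) :=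
  Module.compHom (E →ₗ[R] N) (actHom R E N)

lemma smul_def (φ : (Module.End R E)ᵐᵒᵖ) (g : HomOp R E N) :
    φ • g = (g : E →ₗ[R] N).comp φ.unop := rfl

end HomOp

end GenFinitePaper
/- Tilting and cotilting modules, and special (co)tilting modules. -/

namespace GenFinitePaper

open Function

variable (Γ : Type) [Ring Γ]

/-- A (classical) tilting module:
(T1) projective dimension at most 1;
(T2) no self-extensions (every short exact sequence `0 → T → X → T → 0` splits);
(T3) an exact sequence `0 → Γ → T₀ → T₁ → 0` with `T₀, T₁ ∈ add T`. -/
structure IsTilting (T : Type) [AddCommGroup T] [Module Γ T] : Prop where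
  pdim_le_one : ∃ (P₁ P₀ : Type) (_ : AddCommGroup P₁) (_ : Module Γ P₁)
      (_ : AddCommGroup P₀) (_ : Module Γ P₀) (f : P₁ →ₗ[Γ] P₀) (g : P₀ →ₗ[Γ] T),
      Module.Projective Γ P₁ ∧ Module.Projective Γ P₀ ∧ IsShortExact Γ f g
  rigid : ∀ (X : Type) [AddCommGroup X] [Module Γ X], ∀ (f : T →ₗ[Γ] X) (g : X →ₗ[Γ] T),
      IsShortExact Γ f g → ∃ r : X →ₗ[Γ] T, r.comp f = LinearMap.id
  coresolves : ∃ (T₀ T₁ : Type) (_ : AddCommGroup T₀) (_ : Module Γ T₀)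
      (_ : AddCommGroup T₁) (_ : Module Γ T₁) (f : Γ →ₗ[Γ] T₀) (g : T₀ →ₗ[Γ] T₁),
      InAdd Γ T T₀ ∧ InAdd Γ T T₁ ∧ IsShortExact Γ f g

/-- A `P`-special tilting module, for `P` a projective module: a tilting module `T` with
`P ∈ add T` such that the module `T₀` in (T3) can be chosen in `add P`. -/
structure IsSpecialTilting (P : Type) [AddCommGroup P] [Module Γ P]
    (T : Type) [AddCommGroup T] [Module Γ T] : Prop where
  isTilting : IsTilting Γ T
  mem_add : InAdd Γ T P
  coresolves_special : ∃ (T₀ T₁ : Type) (_ : AddCommGroup T₀) (_ : Module Γ T₀)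
      (_ : AddCommGroup T₁) (_ : Module Γ T₁) (f : Γ →ₗ[Γ] T₀) (g : T₀ →ₗ[Γ] T₁),
      InAdd Γ P T₀ ∧ InAdd Γ T T₁ ∧ IsShortExact Γ f g

variable (K : Type) [Field K] [Algebra K Γ]

/-- A (classical) cotilting module:
(C1) injective dimension at most 1;
(C2) no self-extensions;
(C3) an exact sequence `0 → C1 → C0 → DΓ → 0` with `C0, C1 ∈ add C`,
where `DΓ` is the `K`-linear dual of the regular module. -/
structure IsCotilting (C : Type) [AddCommGroup C] [Module Γ C] : Prop where
  idim_le_one : ∃ (I0 I1 : Type) (_ : AddCommGroup I0) (_ : Module Γ I0)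
      (_ : AddCommGroup I1) (_ : Module Γ I1) (f : C →ₗ[Γ] I0) (g : I0 →ₗ[Γ] I1),
      Module.Injective Γ I0 ∧ Module.Injective Γ I1 ∧ IsShortExact Γ f g
  rigid : ∀ (X : Type) [AddCommGroup X] [Module Γ X], ∀ (f : C →ₗ[Γ] X) (g : X →ₗ[Γ] C),
      IsShortExact Γ f g → ∃ r : X →ₗ[Γ] C, r.comp f = LinearMap.id
  resolves : ∃ (C1 C0 : Type) (_ : AddCommGroup C1) (_ : Module Γ C1)
      (_ : AddCommGroup C0) (_ : Module Γ C0) (f : C1 →ₗ[Γ] C0)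
      (g : C0 →ₗ[Γ] RegularDual K Γ),
      InAdd Γ C C1 ∧ InAdd Γ C C0 ∧ IsShortExact Γ f g

/-- A `Q`-special cotilting module, for `Q` an injective module: a cotilting module `C` with
`Q ∈ add C` such that the module `C0` in (C3) can be chosen in `add Q`. -/
structure IsSpecialCotilting (Q : Type) [AddCommGroup Q] [Module Γ Q]
    (C : Type) [AddCommGroup C] [Module Γ C] : Prop where
  isCotilting : IsCotilting Γ K C
  mem_add : InAdd Γ C Q
  resolves_special : ∃ (C1 C0 : Type) (_ : AddCommGroup C1) (_ : Module Γ C1)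
      (_ : AddCommGroup C0) (_ : Module Γ C0) (f : C1 →ₗ[Γ] C0)
      (g : C0 →ₗ[Γ] RegularDual K Γ),
      InAdd Γ Q C0 ∧ InAdd Γ C C1 ∧ IsShortExact Γ f g

end GenFinitePaper

namespace GenFinitePaper

open Function

section AddGen

variable {R : Type} [Ring R] {X Y M N : Type} [AddCommGroup X] [Module R X]
  [AddCommGroup Y] [Module R Y] [AddCommGroup M] [Module R M] [AddCommGroup N] [Module R N]

lemma InAdd.of_fintype {ι : Type} [Fintype ι] (i : M →ₗ[R] (ι → X)) (p : (ι → X) →ₗ[R] M)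
    (h : p.comp i = LinearMap.id) : InAdd R X M := by
  let e := LinearEquiv.funCongrLeft R X (Fintype.equivFin ι).symm
  refine ⟨Fintype.card ι, e.toLinearMap.comp i, p.comp e.symm.toLinearMap, ?_⟩
  ext x
  simpa using LinearMap.congr_fun h x

lemma InGen.of_fintype {ι : Type} [Fintype ι] (p : (ι → X) →ₗ[R] M) (h : Surjective p) :
    InGen R X M :=
  let e := LinearEquiv.funCongrLeft R X (Fintype.equivFin ι)
  ⟨Fintype.card ι, p.comp e.toLinearMap, h.comp e.surjective⟩

lemma InAdd.trans (h : InAdd R X Y) (h' : InAdd R Y M) : InAdd R X M := by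
  obtain ⟨n, i, p, hip⟩ := h
  obtain ⟨m, j, q, hjq⟩ := h'
  let e := LinearEquiv.curry R X (Fin m) (Fin n)
  refine InAdd.of_fintype (e.symm.toLinearMap.comp ((i.compLeft (Fin m)).comp j))
    ((q.comp (p.compLeft (Fin m))).comp e.toLinearMap) ?_
  have hpi : (p.compLeft (Fin m)).comp (i.compLeft (Fin m)) = LinearMap.id := by
    ext y k
    simpa using LinearMap.congr_fun hip _
  ext x
  have h1 := LinearMap.congr_fun hpi (j x)
  have h2 := LinearMap.congr_fun hjq x
  simp only [LinearMap.comp_apply, LinearMap.id_apply] at h1 h2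
  simp [h1, h2]

lemma InGen.trans (h : InGen R X Y) (h' : InGen R Y M) : InGen R X M := by
  obtain ⟨n, p, hp⟩ := h
  obtain ⟨m, q, hq⟩ := h'
  let e := LinearEquiv.curry R X (Fin m) (Fin n)
  exact InGen.of_fintype ((q.comp (p.compLeft (Fin m))).comp e.toLinearMap)
    ((hq.comp hp.comp_left).comp e.surjective)

lemma InAdd.inGen (h : InAdd R X M) : InGen R X M := by
  obtain ⟨n, i, p, hip⟩ := h
  exact ⟨n, p, fun x => ⟨i x, LinearMap.congr_fun hip x⟩⟩

/-- A linear map killing the kernel of a surjection factors through it. -/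
lemma exists_comp_eq_of_ker_le (π : X →ₗ[R] Y) (hπ : Surjective π) (φ : X →ₗ[R] M)
    (h : LinearMap.ker π ≤ LinearMap.ker φ) : ∃ ψ : Y →ₗ[R] M, ψ.comp π = φ := by
  refine ⟨((LinearMap.ker π).liftQ φ h).comp (π.quotKerEquivOfSurjective hπ).symm.toLinearMap, ?_⟩
  ext x
  have : (π.quotKerEquivOfSurjective hπ).symm (π x) = (LinearMap.ker π).mkQ x := by
    rw [LinearEquiv.symm_apply_eq]; rfl
  simp [this]

/-- A finite module `N` lies in `gen X` if each of its elements lies in the image of a map from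
a fixed module in `gen X`. -/
lemma InGen.of_forall_mem_range [Module.Finite R N] (hY : InGen R X Y)
    (h : ∀ x : N, ∃ u : Y →ₗ[R] N, x ∈ LinearMap.range u) : InGen R X N := by
  obtain ⟨n, s, hs⟩ := Module.Finite.exists_fin (R := R) (M := N)
  choose u hu using fun k => h (s k)
  refine hY.trans ⟨n, LinearMap.lsum R (fun _ => Y) ℕ u, ?_⟩
  rw [← LinearMap.range_eq_top, eq_top_iff, ← hs, Submodule.span_le]
  rintro _ ⟨k, rfl⟩
  obtain ⟨y, hy⟩ := hu k
  exact ⟨Pi.single k y, by rw [LinearMap.lsum_piSingle, hy]⟩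

end AddGen

section ExtVanishing

variable {R : Type} [Ring R]

/-- `Ext¹(M, N) = 0`, phrased as: for every short exact sequence `0 → A → B → M → 0`,
every map `A → N` extends to `B`. -/
def ExtVanishes (R : Type) [Ring R] (M : Type) [AddCommGroup M] [Module R M]
    (N : Type) [AddCommGroup N] [Module R N] : Prop :=
  ∀ (A B : Type) [AddCommGroup A] [Module R A] [AddCommGroup B] [Module R B]
    (a : A →ₗ[R] B) (b : B →ₗ[R] M), IsShortExact R a b →
    ∀ h : A →ₗ[R] N, ∃ e : B →ₗ[R] N, e.comp a = h

variable {M M' N N' P₁ P₀ : Type} [AddCommGroup M] [Module R M] [AddCommGroup M'] [Module R M']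
  [AddCommGroup N] [Module R N] [AddCommGroup N'] [Module R N']
  [AddCommGroup P₁] [Module R P₁] [AddCommGroup P₀] [Module R P₀]

/-- If every extension of `M` by `N` splits, then `Ext¹(M, N) = 0`. -/
lemma ExtVanishes.of_split
    (H : ∀ (X : Type) [AddCommGroup X] [Module R X] (f : N →ₗ[R] X) (g : X →ₗ[R] M),
      IsShortExact R f g → ∃ r : X →ₗ[R] N, r.comp f = LinearMap.id) :
    ExtVanishes R M N := by
  intro A B _ _ _ _ a b ⟨ha, hb, hab⟩ h
  let S : Submodule R (N × B) := LinearMap.range (h.prod (-a))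
  let i : N →ₗ[R] (N × B) ⧸ S := S.mkQ.comp (LinearMap.inl R N B)
  have hS : S ≤ LinearMap.ker (b.comp (LinearMap.snd R N B)) := by
    rintro _ ⟨x, rfl⟩
    simp [hab.apply_apply_eq_zero]
  let g : (N × B) ⧸ S →ₗ[R] M := S.liftQ (b.comp (LinearMap.snd R N B)) hS
  have hses : IsShortExact R i g := by
    refine ⟨?_, ?_, ?_⟩
    · rw [injective_iff_map_eq_zero]
      intro x hx
      obtain ⟨y, hy⟩ := (Submodule.Quotient.mk_eq_zero S).1 hx
      have h1 : h y = x := congrArg Prod.fst hy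
      have h2 : -a y = 0 := congrArg Prod.snd hy
      have h3 : y = 0 := ha (by simpa using h2)
      rw [← h1, h3, map_zero]
    · intro m
      obtain ⟨x, rfl⟩ := hb m
      exact ⟨S.mkQ (0, x), by simp [g]⟩
    · intro z
      constructor
      · obtain ⟨⟨n, x⟩, rfl⟩ := S.mkQ_surjective z
        intro hz
        have hz' : b x = 0 := by simpa [g] using hz
        obtain ⟨y, rfl⟩ := (hab x).1 hz'
        refine ⟨n + h y, ?_⟩
        rw [← sub_eq_zero]
        change S.mkQ _ - S.mkQ _ = 0
        rw [← map_sub, Submodule.mkQ_apply, Submodule.Quotient.mk_eq_zero]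
        exact ⟨y, by simp⟩
      · rintro ⟨n, rfl⟩
        simp [g, i]
  obtain ⟨r, hr⟩ := H _ i g hses
  refine ⟨r.comp (S.mkQ.comp (LinearMap.inr R N B)), ?_⟩
  ext x
  have key : S.mkQ (0, a x) = i (h x) := by
    rw [← sub_eq_zero]
    change S.mkQ _ - S.mkQ _ = 0
    rw [← map_sub, Submodule.mkQ_apply, Submodule.Quotient.mk_eq_zero]
    exact ⟨-x, by simp⟩
  have := LinearMap.congr_fun hr (h x)
  simp only [LinearMap.comp_apply, LinearMap.inr_apply, key]
  simpa using this

/-- Vanishing of `Ext¹(M, N)` can be tested on one projective presentation of `M`. -/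
lemma ExtVanishes.of_presentation [Module.Projective R P₀] {f : P₁ →ₗ[R] P₀} {g : P₀ →ₗ[R] M}
    (hfg : IsShortExact R f g) (H : ∀ h : P₁ →ₗ[R] N, ∃ e : P₀ →ₗ[R] N, e.comp f = h) :
    ExtVanishes R M N := by
  obtain ⟨_, hg, hfg⟩ := hfg
  intro A B _ _ _ _ a b ⟨ha, hb, hab⟩ h
  obtain ⟨l, hl⟩ := Module.projective_lifting_property b g hb
  have hl' : ∀ x, b (l x) = g x := LinearMap.congr_fun hl
  have hrange : ∀ y, l (f y) ∈ LinearMap.range a := fun y =>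
    (hab _).1 (by rw [hl', hfg.apply_apply_eq_zero])
  let a' := LinearEquiv.ofInjective a ha
  let c : P₁ →ₗ[R] A := a'.symm.toLinearMap.comp ((l.comp f).codRestrict _ hrange)
  have hc : ∀ y, a (c y) = l (f y) := fun y => by
    have := congrArg Subtype.val (a'.apply_symm_apply ((l.comp f).codRestrict _ hrange y))
    exact this
  obtain ⟨e, he⟩ := H (h.comp c)
  have he' : ∀ y, e (f y) = h (c y) := LinearMap.congr_fun he
  obtain ⟨ψ, hψ⟩ := exists_comp_eq_of_ker_le (a.coprod l) (by
    intro x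
    obtain ⟨y, hy⟩ := hg (b x)
    obtain ⟨z, hz⟩ := (hab (x - l y)).1 (by rw [map_sub, hl', hy, sub_self])
    exact ⟨(z, y), by simp [hz]⟩) (h.coprod e) (by
    rintro ⟨x, y⟩ hxy
    have hxy' : a x + l y = 0 := by simpa using hxy
    have hgy : g y = 0 := by
      have := congrArg b hxy'
      simpa [hab.apply_apply_eq_zero, hl'] using this
    obtain ⟨z, rfl⟩ := (hfg y).1 hgy
    have hx : x = - c z := ha (by
      rw [map_neg, hc]; exact eq_neg_of_add_eq_zero_left hxy')
    simp [he', hx])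
  refine ⟨ψ, ?_⟩
  ext x
  simpa using LinearMap.congr_fun hψ (x, 0)

lemma ExtVanishes.of_surjective [Module.Projective R P₁] [Module.Projective R P₀]
    {f : P₁ →ₗ[R] P₀} {g : P₀ →ₗ[R] M} (hfg : IsShortExact R f g) (H : ExtVanishes R M N)
    (q : N →ₗ[R] N') (hq : Surjective q) : ExtVanishes R M N' := by
  refine ExtVanishes.of_presentation hfg fun h => ?_
  obtain ⟨l, hl⟩ := Module.projective_lifting_property q h hq
  obtain ⟨e, he⟩ := H _ _ f g hfg l
  exact ⟨q.comp e, by rw [LinearMap.comp_assoc, he, hl]⟩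

lemma ExtVanishes.pi_right (H : ExtVanishes R M N) (ι : Type) :
    ExtVanishes R M (ι → N) := by
  intro A B _ _ _ _ a b hab h
  choose e he using fun k => H A B a b hab ((LinearMap.proj k).comp h)
  refine ⟨LinearMap.pi e, ?_⟩
  ext x k
  exact LinearMap.congr_fun (he k) x

lemma ExtVanishes.pi_left [Module.Projective R P₀] {f : P₁ →ₗ[R] P₀} {g : P₀ →ₗ[R] M}
    (hfg : IsShortExact R f g) (H : ExtVanishes R M N) (n : ℕ) :
    ExtVanishes R (Fin n → M) N := by
  have hses : IsShortExact R (f.compLeft (Fin n)) (g.compLeft (Fin n)) := by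
    refine ⟨hfg.1.comp_left, hfg.2.1.comp_left, fun x => ⟨fun hx => ?_, ?_⟩⟩
    · choose y hy using fun k => (hfg.2.2 (x k)).1 (congrFun hx k)
      exact ⟨y, funext hy⟩
    · rintro ⟨y, rfl⟩
      funext k
      exact hfg.2.2.apply_apply_eq_zero _
  have : Module.Projective R (Fin n → P₀) :=
    Module.Projective.of_equiv (DFinsupp.linearEquivFunOnFintype (R := R) (M := fun _ : Fin n => P₀))
  refine ExtVanishes.of_presentation hses fun h => ?_
  choose e he using fun k => H _ _ f g hfg (h.comp (LinearMap.single R (fun _ => P₁) k))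
  refine ⟨LinearMap.lsum R (fun _ => P₀) ℕ e, ?_⟩
  refine LinearMap.pi_ext fun k y => ?_
  have h1 : f.compLeft (Fin n) (Pi.single k y) = Pi.single k (f y) := by
    funext j
    by_cases hj : j = k
    · subst hj; simp
    · simp [hj]
  rw [LinearMap.comp_apply, h1, LinearMap.lsum_piSingle]
  exact LinearMap.congr_fun (he k) y

lemma ExtVanishes.retract_left (H : ExtVanishes R M N) (i : M' →ₗ[R] M) (p : M →ₗ[R] M')
    (hip : p.comp i = LinearMap.id) : ExtVanishes R M' N := by
  intro A B _ _ _ _ a b ⟨ha, hb, hab⟩ h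
  have hip' : ∀ x, p (i x) = x := LinearMap.congr_fun hip
  let S : Submodule R (B × M) := LinearMap.eqLocus (b.comp (LinearMap.fst R B M))
    (p.comp (LinearMap.snd R B M))
  let a' : A →ₗ[R] S := (a.prod 0).codRestrict S fun x => by
    simp [S, hab.apply_apply_eq_zero]
  let b' : S →ₗ[R] M := (LinearMap.snd R B M).comp S.subtype
  obtain ⟨e, he⟩ := H A S a' b' ⟨fun x y hxy => ha (congrArg (fun z : S => z.1.1) hxy),
    fun m => by
      obtain ⟨x, hx⟩ := hb (p m)
      exact ⟨⟨(x, m), hx⟩, rfl⟩,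
    fun z => by
      constructor
      · obtain ⟨⟨x, m⟩, hz⟩ := z
        rintro (rfl : m = 0)
        have hz' : b x = p 0 := hz
        obtain ⟨y, rfl⟩ := (hab x).1 (by rw [hz', map_zero])
        exact ⟨y, rfl⟩
      · rintro ⟨y, rfl⟩
        rfl⟩ h
  let s : B →ₗ[R] S := (LinearMap.id.prod (i.comp b)).codRestrict S fun x => by
    simp [S, hip']
  refine ⟨e.comp s, ?_⟩
  rw [← he]
  ext x
  refine congrArg e (Subtype.ext ?_)
  simp [s, a', hab.apply_apply_eq_zero]

/-- The kernel of a right `add M`-approximation of a rigid module `M` has no extensions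
by `M`. -/
lemma ExtVanishes.ker_of_approximation (H : ExtVanishes R M M) {n : ℕ}
    (p : (Fin n → M) →ₗ[R] N) (hp : ∀ u : M →ₗ[R] N, ∃ v : M →ₗ[R] (Fin n → M), p.comp v = u) :
    ExtVanishes R M (LinearMap.ker p) := by
  intro A B _ _ _ _ a b hab h
  obtain ⟨k, hk⟩ := H.pi_right (Fin n) A B a b hab ((LinearMap.ker p).subtype.comp h)
  have hk' : ∀ x, k (a x) = h x := LinearMap.congr_fun hk
  obtain ⟨u, hu⟩ := exists_comp_eq_of_ker_le b hab.2.1 (p.comp k) (fun x hx => by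
    obtain ⟨y, rfl⟩ := (hab.2.2 x).1 hx
    simp [hk'])
  obtain ⟨v, rfl⟩ := hp u
  refine ⟨(k - v.comp b).codRestrict _ fun x => ?_, ?_⟩
  · have := LinearMap.congr_fun hu x
    simp only [LinearMap.comp_apply] at this
    simp [this]
  · ext1 x
    refine Subtype.ext ?_
    simp [hk', hab.2.2.apply_apply_eq_zero]

end ExtVanishing

/-- Over a finite-dimensional algebra, every finite module in `gen M` has a surjective right
`add M`-approximation. -/
lemma InGen.exists_approximation (K : Type) {Γ : Type} [Field K] [Ring Γ] [Algebra K Γ]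
    [FiniteDimensional K Γ] {M N : Type} [AddCommGroup M] [Module Γ M] [Module.Finite Γ M]
    [AddCommGroup N] [Module Γ N] [Module.Finite Γ N] (h : InGen Γ M N) :
    ∃ (n : ℕ) (p : (Fin n → M) →ₗ[Γ] N), Surjective p ∧
      ∀ u : M →ₗ[Γ] N, ∃ v : M →ₗ[Γ] (Fin n → M), p.comp v = u := by
  let : Module K M := Module.compHom M (algebraMap K Γ)
  let : Module K N := Module.compHom N (algebraMap K Γ)
  have : IsScalarTower K Γ M := IsScalarTower.of_algebraMap_smul fun _ _ => rfl
  have : IsScalarTower K Γ N := IsScalarTower.of_algebraMap_smul fun _ _ => rfl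
  have : SMulCommClass Γ K M := SMulCommClass.symm K Γ M
  have : SMulCommClass Γ K N := SMulCommClass.symm K Γ N
  have : Module.Finite K M := Module.Finite.trans Γ M
  have : Module.Finite K N := Module.Finite.trans Γ N
  have : Module.Finite K (M →ₗ[Γ] N) :=
    Module.Finite.of_injective (LinearMap.restrictScalarsₗ K Γ M N K)
      (LinearMap.restrictScalars_injective K)
  obtain ⟨n, s, hs⟩ := Module.Finite.exists_fin (R := K) (M := M →ₗ[Γ] N)
  have hlift : ∀ u : M →ₗ[Γ] N, ∃ v : M →ₗ[Γ] (Fin n → M),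
      (LinearMap.lsum Γ (fun _ => M) ℕ s).comp v = u := by
    intro u
    obtain ⟨c, rfl⟩ := (Submodule.mem_span_range_iff_exists_fun K).1
      (hs ▸ Submodule.mem_top : u ∈ Submodule.span K (Set.range s))
    refine ⟨LinearMap.pi fun k => c k • LinearMap.id, ?_⟩
    ext x
    simp only [LinearMap.comp_apply, LinearMap.lsum_apply, LinearMap.sum_apply,
      LinearMap.proj_apply, LinearMap.pi_apply, LinearMap.smul_apply, LinearMap.id_apply]
    exact Finset.sum_congr rfl fun k _ =>
      (LinearMap.restrictScalars K (s k)).map_smul (c k) x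
  refine ⟨n, _, ?_, hlift⟩
  obtain ⟨m, q, hq⟩ := h
  rw [← LinearMap.range_eq_top, eq_top_iff, ← LinearMap.range_eq_top.2 hq]
  rintro _ ⟨x, rfl⟩
  rw [← Finset.univ_sum_single x, map_sum]
  refine Submodule.sum_mem _ fun k _ => ?_
  obtain ⟨v, hv⟩ := hlift (q.comp (LinearMap.single Γ (fun _ => M) k))
  exact ⟨v (x k), LinearMap.congr_fun hv (x k)⟩

section Tilting

variable {Γ : Type} [Ring Γ] {P T M N : Type} [AddCommGroup P] [Module Γ P]
  [AddCommGroup T] [Module Γ T] [AddCommGroup M] [Module Γ M] [AddCommGroup N] [Module Γ N]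

lemma IsTilting.extVanishes_self (hT : IsTilting Γ T) : ExtVanishes Γ T T :=
  ExtVanishes.of_split hT.rigid

lemma IsTilting.extVanishes_of_inGen (hT : IsTilting Γ T) (h : InGen Γ T N) :
    ExtVanishes Γ T N := by
  obtain ⟨P₁, P₀, _, _, _, _, f, g, _, _, hfg⟩ := hT.pdim_le_one
  obtain ⟨n, q, hq⟩ := h
  exact (hT.extVanishes_self.pi_right (Fin n)).of_surjective hfg q hq

lemma IsTilting.extVanishes_of_inAdd (hT : IsTilting Γ T) (hM : InAdd Γ T M)
    (h : ExtVanishes Γ T N) : ExtVanishes Γ M N := by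
  obtain ⟨P₁, P₀, _, _, _, _, f, g, _, _, hfg⟩ := hT.pdim_le_one
  obtain ⟨n, i, p, hip⟩ := hM
  exact (h.pi_left hfg n).retract_left i p hip

lemma IsSpecialTilting.inGen_of_extVanishes [Module.Finite Γ N] (hT : IsSpecialTilting Γ P T)
    (h : ExtVanishes Γ T N) : InGen Γ P N := by
  obtain ⟨T₀, T₁, _, _, _, _, f, g, hT₀, hT₁, hfg⟩ := hT.coresolves_special
  refine hT₀.inGen.of_forall_mem_range fun x => ?_
  obtain ⟨e, he⟩ := hT.isTilting.extVanishes_of_inAdd hT₁ h _ _ f g hfg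
    (LinearMap.toSpanSingleton Γ N x)
  exact ⟨e, f 1, by simpa using LinearMap.congr_fun he 1⟩

end Tilting

lemma IsSpecialTilting.inAdd (K : Type) {Γ : Type} [Field K] [Ring Γ] [Algebra K Γ]
    [FiniteDimensional K Γ] {P T T' : Type} [AddCommGroup P] [Module Γ P]
    [AddCommGroup T] [Module Γ T] [Module.Finite Γ T]
    [AddCommGroup T'] [Module Γ T'] [Module.Finite Γ T']
    (hT : IsSpecialTilting Γ P T) (hT' : IsSpecialTilting Γ P T') : InAdd Γ T' T := by
  have : IsNoetherianRing Γ := IsNoetherianRing.of_finite K Γ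
  have hgen : InGen Γ T' T :=
    hT'.mem_add.inGen.trans (hT.inGen_of_extVanishes hT.isTilting.extVanishes_self)
  obtain ⟨n, p, hp, hlift⟩ := hgen.exists_approximation K
  have hker : InGen Γ P (LinearMap.ker p) := hT'.inGen_of_extVanishes
    (hT'.isTilting.extVanishes_self.ker_of_approximation p hlift)
  obtain ⟨r, hr⟩ := hT.isTilting.extVanishes_of_inGen (hT.mem_add.inGen.trans hker) _ _
    (LinearMap.ker p).subtype p
    ⟨Subtype.val_injective, hp, LinearMap.exact_subtype_ker_map p⟩ LinearMap.id
  obtain ⟨s, hs⟩ := exists_comp_eq_of_ker_le p hp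
    (LinearMap.id - (LinearMap.ker p).subtype.comp r) (fun x hx => by
      have := LinearMap.congr_fun hr ⟨x, hx⟩
      simp only [LinearMap.comp_apply, Submodule.subtype_apply, LinearMap.id_apply] at this
      simp [this])
  refine ⟨n, s, p, ?_⟩
  ext y
  obtain ⟨x, rfl⟩ := hp y
  have := congrArg p (LinearMap.congr_fun hs x)
  simpa using this

section KrullSchmidt

/-- `X` is isomorphic to a direct summand of `M`. -/
def IsSummand (R : Type) [Ring R] (X : Type) [AddCommGroup X] [Module R X]
    (M : Type) [AddCommGroup M] [Module R M] : Prop :=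
  ∃ (i : X →ₗ[R] M) (p : M →ₗ[R] X), p.comp i = LinearMap.id

variable {R : Type} [Ring R] {X Y M N : Type} [AddCommGroup X] [Module R X]
  [AddCommGroup Y] [Module R Y] [AddCommGroup M] [Module R M] [AddCommGroup N] [Module R N]

lemma IsSummand.trans (h : IsSummand R X Y) (h' : IsSummand R Y M) : IsSummand R X M := by
  obtain ⟨i, p, hip⟩ := h
  obtain ⟨j, q, hjq⟩ := h'
  refine ⟨j.comp i, p.comp q, ?_⟩
  rw [LinearMap.comp_assoc, ← LinearMap.comp_assoc i, hjq, LinearMap.id_comp, hip]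

lemma IsSummand.of_equiv (e : X ≃ₗ[R] M) : IsSummand R X M :=
  ⟨e.toLinearMap, e.symm.toLinearMap, by ext; simp⟩

lemma IsSummand.inr : IsSummand R Y (X × Y) :=
  ⟨LinearMap.inr R X Y, LinearMap.snd R X Y, by ext; simp⟩

lemma IsSummand.prod_left (h : IsSummand R Y M) : IsSummand R (X × Y) (X × M) := by
  obtain ⟨i, p, hip⟩ := h
  refine ⟨LinearMap.id.prodMap i, LinearMap.id.prodMap p, ?_⟩
  rw [LinearMap.prodMap_comp, hip, LinearMap.id_comp, LinearMap.prodMap_id]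

lemma IsSummand.exists_equiv_prod (h : IsSummand R X M) :
    ∃ Y : Submodule R M, Nonempty (M ≃ₗ[R] X × Y) := by
  obtain ⟨i, p, hip⟩ := h
  have hip' : ∀ x, p (i x) = x := LinearMap.congr_fun hip
  refine ⟨LinearMap.ker p, ⟨LinearEquiv.ofLinearMap
    (p.prod ((LinearMap.id - i.comp p).codRestrict _ fun x => by simp [hip']))
    (i.coprod (LinearMap.ker p).subtype) ?_ ?_⟩⟩
  · ext x
    · simp [hip']
    · simp [hip']
    · simp
    · simp
  · ext x
    simp

lemma Indecomposable.eq_bot_or_eq_bot (hX : Indecomposable R X) {S C : Submodule R X}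
    (h : IsCompl S C) : S = ⊥ ∨ C = ⊥ := by
  obtain h0 | h1 := hX.2 (S.projection C h) (Submodule.isIdempotentElem_projection h)
  · left
    rw [← Submodule.range_projection h, h0, LinearMap.range_zero]
  · right
    rw [← Submodule.ker_projection h, h1, LinearMap.ker_id]

/-- Fitting's lemma. -/
lemma Indecomposable.isUnit_or_isNilpotent [IsArtinian R X] [IsNoetherian R X]
    (hX : Indecomposable R X) (f : Module.End R X) : IsUnit f ∨ IsNilpotent f := by
  obtain ⟨n, hn, hn1⟩ := (f.eventually_isCompl_ker_pow_range_pow.and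
    (Filter.eventually_ge_atTop 1)).exists
  obtain h | h := hX.eq_bot_or_eq_bot hn
  · left
    rw [Module.End.isUnit_iff]
    refine IsArtinian.bijective_of_injective_endomorphism f ?_
    rw [LinearMap.ker_eq_bot] at h
    obtain ⟨m, rfl⟩ := Nat.exists_eq_add_of_le' hn1
    rw [pow_succ] at h
    exact Injective.of_comp (f := ⇑(f ^ m)) h
  · exact Or.inr ⟨n, LinearMap.range_eq_bot.1 h⟩

lemma Indecomposable.isSummand_or_of_prod [IsArtinian R X] [IsNoetherian R X]
    (hX : Indecomposable R X) (h : IsSummand R X (M × N)) :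
    IsSummand R X M ∨ IsSummand R X N := by
  obtain ⟨i, p, hip⟩ := h
  have aux : ∀ {L : Type} [AddCommGroup L] [Module R L] (j : X →ₗ[R] L) (q : L →ₗ[R] X),
      IsUnit (q.comp j : Module.End R X) → IsSummand R X L := by
    intro L _ _ j q hu
    obtain ⟨v, hv⟩ := hu.exists_left_inv
    exact ⟨j, v.comp q, hv⟩
  let a : Module.End R X := (p.comp (LinearMap.inl R M N)).comp ((LinearMap.fst R M N).comp i)
  let b : Module.End R X := (p.comp (LinearMap.inr R M N)).comp ((LinearMap.snd R M N).comp i)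
  have hab : b = 1 - a := by
    rw [eq_sub_iff_add_eq]
    ext x
    have := LinearMap.congr_fun hip x
    simp only [a, b, LinearMap.add_apply, LinearMap.comp_apply, ← map_add]
    simpa using this
  obtain h | h := hX.isUnit_or_isNilpotent a
  · exact Or.inl (aux _ _ h)
  · exact Or.inr (aux _ _ (show IsUnit b from hab ▸ h.isUnit_one_sub))

lemma Indecomposable.isSummand_of_pi [IsArtinian R X] [IsNoetherian R X]
    (hX : Indecomposable R X) : ∀ n : ℕ, IsSummand R X (Fin n → M) → IsSummand R X M
  | 0, ⟨i, p, hip⟩ => by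
    have := hX.1
    obtain ⟨x, hx⟩ := exists_ne (0 : X)
    refine absurd ?_ hx
    rw [← LinearMap.id_apply (R := R) x, ← hip, LinearMap.comp_apply, Subsingleton.elim (i x) 0,
      map_zero]
  | n + 1, h => by
    obtain h | h := hX.isSummand_or_of_prod
      (h.trans (IsSummand.of_equiv (Fin.consLinearEquiv R (fun _ : Fin (n + 1) => M)).symm))
    · exact h
    · exact hX.isSummand_of_pi n h

lemma IsSummand.nonempty_equiv_of_indecomposable [Nontrivial Y] (hX : Indecomposable R X)
    (h : IsSummand R Y X) : Nonempty (Y ≃ₗ[R] X) := by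
  obtain ⟨i, p, hip⟩ := h
  have hip' : ∀ x, p (i x) = x := LinearMap.congr_fun hip
  obtain h0 | h1 := hX.2 (i.comp p) (by ext x; simp [hip'])
  · obtain ⟨y, hy⟩ := exists_ne (0 : Y)
    refine absurd ?_ hy
    have := congrArg p (LinearMap.congr_fun h0 (i y))
    simpa [hip'] using this
  · exact ⟨LinearEquiv.ofLinearMap i p h1 hip⟩

lemma exists_indecomposable_isSummand [IsArtinian R M] [Nontrivial M] :
    ∃ X : Submodule R M, Indecomposable R X ∧ IsSummand R X M := by
  obtain ⟨S, ⟨hS, e, heS, he⟩, hmin⟩ := (wellFounded_lt (α := Submodule R M)).has_min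
    {S | S ≠ ⊥ ∧ ∃ e : M →ₗ[R] M, (∀ x, e x ∈ S) ∧ ∀ x ∈ S, e x = x}
    ⟨⊤, top_ne_bot, LinearMap.id, fun _ => Submodule.mem_top, fun _ _ => rfl⟩
  refine ⟨S, ⟨Submodule.nontrivial_iff_ne_bot.2 hS, fun φ hφ => ?_⟩, S.subtype,
    e.codRestrict S heS, by ext x; simp [he x.1 x.2]⟩
  have hφ' : ∀ x, φ (φ x) = φ x := LinearMap.congr_fun hφ
  by_cases h0 : φ = 0
  · exact Or.inl h0
  right
  have hW : ¬ (LinearMap.range φ).map S.subtype < S := by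
    refine hmin _ ⟨?_, S.subtype.comp (φ.comp (e.codRestrict S heS)), fun x =>
      ⟨_, ⟨_, rfl⟩, rfl⟩, ?_⟩
    · intro h
      rw [← Submodule.map_bot S.subtype] at h
      exact h0 (LinearMap.range_eq_bot.1
        (Submodule.map_injective_of_injective S.injective_subtype h))
    · rintro _ ⟨_, ⟨x, rfl⟩, rfl⟩
      have : e.codRestrict S heS (φ x : M) = φ x := Subtype.ext (he _ (φ x).2)
      simp [this, hφ']
  have hle : (LinearMap.range φ).map S.subtype ≤ S := Submodule.map_subtype_le _ _
  have heq := eq_of_le_of_not_lt hle hW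
  ext1 x
  obtain ⟨_, ⟨y, rfl⟩, hy⟩ := (heq.symm ▸ x.2 : (x : M) ∈ (LinearMap.range φ).map S.subtype)
  rw [← Subtype.ext hy, hφ', LinearMap.id_apply]

lemma IsBasic.of_isSummand (hM : IsBasic R M) (h : IsSummand R Y M) : IsBasic R Y := by
  obtain ⟨W, ⟨e⟩⟩ := h.exists_equiv_prod
  intro Z V _ _ _ _ ⟨e'⟩
  exact hM Z (V × W) ⟨(e.trans (e'.prodCongr (LinearEquiv.refl R W))).trans
    (LinearEquiv.prodAssoc R _ _ _)⟩

/-- Over an Artinian ring, a basic finite module is a direct summand of any finite module having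
all its indecomposable summands as summands. -/
lemma IsBasic.isSummand_of_forall_indecomposable [IsNoetherianRing R] [IsArtinianRing R] (n : ℕ) :
    ∀ (A B : Type) [AddCommGroup A] [Module R A] [AddCommGroup B] [Module R B]
      [Module.Finite R A] [Module.Finite R B], Module.length R A ≤ n → IsBasic R A →
      (∀ (X : Type) [AddCommGroup X] [Module R X], Indecomposable R X → IsSummand R X A →
        IsSummand R X B) → IsSummand R A B := by
  induction n with
  | zero =>
    intro A B _ _ _ _ _ _ hlen _ _
    have : Subsingleton A := Module.length_eq_zero_iff.1 (by simpa using hlen)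
    exact ⟨0, 0, Subsingleton.elim _ _⟩
  | succ n ih =>
    intro A B _ _ _ _ _ _ hlen hA hAB
    obtain h | h := subsingleton_or_nontrivial A
    · exact ⟨0, 0, Subsingleton.elim _ _⟩
    obtain ⟨X, hX, hXA⟩ := exists_indecomposable_isSummand (R := R) (M := A)
    obtain ⟨A', ⟨eA⟩⟩ := hXA.exists_equiv_prod
    obtain ⟨B', ⟨eB⟩⟩ := (hAB X hX hXA).exists_equiv_prod
    have hA'A : IsSummand R A' A := IsSummand.inr.trans (.of_equiv eA.symm)
    have := hX.1
    have hlen' : Module.length R A' ≤ n := by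
      rw [eA.length_eq, Module.length_prod, Nat.cast_succ, add_comm] at hlen
      refine (ENat.add_le_add_iff_right ENat.one_ne_top).1 (le_trans ?_ hlen)
      gcongr
      exact Order.one_le_iff_pos.2 Module.length_pos
    refine (IsSummand.of_equiv eA).trans (IsSummand.trans (IsSummand.prod_left ?_)
      (.of_equiv eB.symm))
    refine ih A' B' hlen' (hA.of_isSummand hA'A) fun Y _ _ hY hYA' => ?_
    obtain ⟨W, ⟨e⟩⟩ := hYA'.exists_equiv_prod
    have hYA := hYA'.trans hA'A
    obtain ⟨j, q, hjq⟩ := id hYA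
    have hj : Injective j := (LeftInverse.injective (g := q) (LinearMap.congr_fun hjq))
    have : IsArtinian R Y := isArtinian_of_injective j hj
    have : IsNoetherian R Y := isNoetherian_of_injective j hj
    refine (hY.isSummand_or_of_prod
      ((hAB Y hY hYA).trans (.of_equiv eB))).resolve_left fun hYX => ?_
    have := hY.1
    obtain ⟨u⟩ := hYX.nonempty_equiv_of_indecomposable hX
    refine not_subsingleton X (hA X W ⟨(eA.trans ((LinearEquiv.refl R X).prodCongr
      (e.trans (u.prodCongr (LinearEquiv.refl R W))))).trans
      (LinearEquiv.prodAssoc R _ _ _).symm⟩)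

lemma IsBasic.isSummand_of_inAdd [IsNoetherianRing R] [IsArtinianRing R] [Module.Finite R M]
    [Module.Finite R N] (hM : IsBasic R M) (h : InAdd R N M) : IsSummand R M N := by
  obtain ⟨n, i, p, hip⟩ := h
  obtain ⟨k, hk⟩ := ENat.ne_top_iff_exists.1 (Module.length_ne_top (R := R) (M := M))
  refine IsBasic.isSummand_of_forall_indecomposable k M N hk.ge hM fun X _ _ hX hXM => ?_
  obtain ⟨j, q, hjq⟩ := id hXM
  have hj : Injective j := LeftInverse.injective (g := q) (LinearMap.congr_fun hjq)
  have : IsArtinian R X := isArtinian_of_injective j hj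
  have : IsNoetherian R X := isNoetherian_of_injective j hj
  exact hX.isSummand_of_pi n (hXM.trans ⟨i, p, hip⟩)

lemma IsSummand.nonempty_equiv [IsArtinian R N] (h : IsSummand R M N) (h' : IsSummand R N M) :
    Nonempty (M ≃ₗ[R] N) := by
  obtain ⟨i, p, hip⟩ := h
  obtain ⟨j, q, hjq⟩ := h'
  have hi : Injective i := LeftInverse.injective (g := p) (LinearMap.congr_fun hip)
  have hj : Injective j := LeftInverse.injective (g := q) (LinearMap.congr_fun hjq)
  have hij := IsArtinian.bijective_of_injective_endomorphism (i.comp j) (hi.comp hj)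
  exact ⟨LinearEquiv.ofBijective i ⟨hi, Surjective.of_comp (g := j) hij.2⟩⟩

end KrullSchmidt

/-- Let `Γ` be a finite-dimensional `K`-algebra and `P` a projective
`Γ`-module. If `T` and `T'` are both `P`-special tilting `Γ`-modules, then
`add T = add T'`; in particular, any two basic `P`-special tilting `Γ`-modules are
isomorphic. -/
theorem uniqueness_of_special_tilting
    (K Γ : Type) [Field K] [Ring Γ] [Algebra K Γ] [FiniteDimensional K Γ]
    (P : Type) [AddCommGroup P] [Module Γ P] (hPfin : Module.Finite Γ P)
    (hP : Module.Projective Γ P)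
    (T : Type) [AddCommGroup T] [Module Γ T] (hTfin : Module.Finite Γ T)
    (T' : Type) [AddCommGroup T'] [Module Γ T'] (hT'fin : Module.Finite Γ T')
    (hT : IsSpecialTilting Γ P T) (hT' : IsSpecialTilting Γ P T') :
    (∀ (M : Type) [AddCommGroup M] [Module Γ M], (InAdd Γ T M ↔ InAdd Γ T' M)) ∧
      (IsBasic Γ T → IsBasic Γ T' → Nonempty (T ≃ₗ[Γ] T')) := by
  have hadd : InAdd Γ T' T := IsSpecialTilting.inAdd K hT hT'
  have hadd' : InAdd Γ T T' := IsSpecialTilting.inAdd K hT' hT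
  refine ⟨fun M _ _ => ⟨hadd.trans, hadd'.trans⟩, fun hb hb' => ?_⟩
  have : IsNoetherianRing Γ := IsNoetherianRing.of_finite K Γ
  have : IsArtinianRing Γ := IsArtinianRing.of_finite K Γ
  exact (hb.isSummand_of_inAdd hadd).nonempty_equiv (hb'.isSummand_of_inAdd hadd')

end GenFinitePaper
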